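/- Let G be a finite graph and let X be a subset of vertices of G. Then cmp(G) ≤ cmp(G − X) + |X|, where G − X denotes the subgraph of G induced by V(G) \ X. -/

import Mathlib

open SimpleGraph

/-- `(F, W)` is a suitable forest decomposition of `G`: `F` is a forest that is
a subgraph of `G` on the same vertex set, for every vertex `u` of `G` the set of
nodes whose bag contains `u` induces a nonempty connected subgraph of `F`, every
edge of `G` is contained in some bag, and every vertex belongs to its own bag. -/
def IsSuitableForestDecomp {V : Type*} (G F : SimpleGraph V) (W : V → Set V) : Prop :=
  F.IsAcyclic ∧ F ≤ G ∧
  (∀ u : V, (F.induce {x | u ∈ W x}).Connected) ∧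
  (∀ u v : V, G.Adj u v → ∃ x, u ∈ W x ∧ v ∈ W x) ∧
  (∀ u : V, u ∈ W u)

/-- The complexity `cmp G` of a graph `G`: the minimum width (maximum bag size
minus one) of a suitable forest decomposition of `G`. -/
noncomputable def complexity {V : Type*} (G : SimpleGraph V) : ℕ :=
  sInf {w | ∃ (F : SimpleGraph V) (W : V → Set V),
    IsSuitableForestDecomp G F W ∧ ∀ x, (W x).ncard ≤ w + 1}

theorem isAcyclic_map_subtype {V : Type*} (s : Set V) (F : SimpleGraph s) (hF : F.IsAcyclic) :
    (F.map (Function.Embedding.subtype (· ∈ s))).IsAcyclic := by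
  intro v c hc
  have hs : ∀ x ∈ c.support, x ∈ s := by
    intro x hx
    obtain ⟨e, he, hxe⟩ := (Walk.mem_support_iff_exists_mem_edges_of_not_nil hc.not_nil).1 hx
    have h2 := c.edges_subset_edgeSet he
    induction e with
    | h a b =>
      simp only [mem_edgeSet, SimpleGraph.map_adj] at h2
      obtain ⟨a', b', -, rfl, rfl⟩ := h2
      simp only [Sym2.mem_iff] at hxe
      rcases hxe with rfl | rfl
      · exact a'.2
      · exact b'.2
  have hcyc : (c.induce s hs).IsCycle := by
    apply Walk.IsCycle.of_map
    rw [Walk.map_induce]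
    exact hc
  have h3 : ((F.map (Function.Embedding.subtype (· ∈ s))).induce s).IsAcyclic := by
    have : (F.map (Function.Embedding.subtype (· ∈ s))).induce s = F := by
      exact SimpleGraph.comap_map_eq (Function.Embedding.subtype (· ∈ s)) F
    rw [this]
    exact hF
  exact h3 _ hcyc

theorem connected_induce_reachable {V : Type*} (G F : SimpleGraph V)
    (h : F.Reachable = G.Reachable) (u : V) :
    (F.induce {x | G.Reachable u x}).Connected := by
  have := (F.connectedComponentMk u).connected_toSimpleGraph
  have e : (F.connectedComponentMk u).supp = {x | G.Reachable u x} := by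
    ext x
    simp only [ConnectedComponent.mem_supp_iff, ConnectedComponent.eq, Set.mem_ofPred_eq, ← h]
    exact ⟨fun h => h.symm, fun h => h.symm⟩
  rw [← e]
  exact this

theorem complexity_spec {V : Type*} [Finite V] (G : SimpleGraph V) :
    ∃ (F : SimpleGraph V) (W : V → Set V),
      IsSuitableForestDecomp G F W ∧ ∀ x, (W x).ncard ≤ complexity G + 1 := by
  refine Nat.sInf_mem (s := {w | ∃ (F : SimpleGraph V) (W : V → Set V),
    IsSuitableForestDecomp G F W ∧ ∀ x, (W x).ncard ≤ w + 1}) ?_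
  obtain ⟨F, hFG, hF, hr⟩ := G.exists_isAcyclic_reachable_eq_le
  refine ⟨Nat.card V, F, fun x => {u | G.Reachable u x}, ⟨hF, hFG, ?_, ?_, ?_⟩, ?_⟩
  · exact connected_induce_reachable G F hr
  · intro u v h
    exact ⟨u, Reachable.refl _, h.symm.reachable⟩
  · intro u
    exact Reachable.refl _
  · intro x
    have := Set.ncard_le_card {u | G.Reachable u x}
    exact this.trans (Nat.le_succ _)

/-- For a finite graph `G` and a set `X` of vertices of `G`,
`cmp(G) ≤ cmp(G − X) + |X|`, where `G − X` is the subgraph of `G` induced by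
`V(G) \ X`. -/
theorem complexity_deleteVerts {V : Type*} [Fintype V] (G : SimpleGraph V) (X : Set V) :
    complexity G ≤ complexity (G.induce Xᶜ) + X.ncard := by
  obtain ⟨F, W, ⟨hF, hFG, hconn, hedge, hself⟩, hW⟩ := complexity_spec (G.induce Xᶜ)
  have hle : F.map (Function.Embedding.subtype (· ∈ Xᶜ)) ≤ G := by
    intro a b hab
    obtain ⟨a', b', h, rfl, rfl⟩ := (SimpleGraph.map_adj _ _ _ _).1 hab
    exact hFG h
  obtain ⟨F', hFF', hF'G, hF', hr⟩ :=
    G.exists_isAcyclic_reachable_eq_le_of_le_of_isAcyclic hle (isAcyclic_map_subtype _ F hF)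
  refine Nat.sInf_le ⟨F', fun x => {u | u ∈ X ∧ G.Reachable u x} ∪
    {u | ∃ (hu : u ∈ Xᶜ) (hx : x ∈ Xᶜ), (⟨u, hu⟩ : ↥Xᶜ) ∈ W ⟨x, hx⟩},
    ⟨hF', hF'G, ?_, ?_, ?_⟩, ?_⟩
  · intro u
    by_cases hu : u ∈ X
    · have e : {x | G.Reachable u x} = {x | u ∈ {u | u ∈ X ∧ G.Reachable u x} ∪
          {u | ∃ (hu : u ∈ Xᶜ) (hx : x ∈ Xᶜ), (⟨u, hu⟩ : ↥Xᶜ) ∈ W ⟨x, hx⟩}} := by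
        ext x
        constructor
        · intro h
          exact Or.inl ⟨hu, h⟩
        · rintro (h | ⟨h, _⟩)
          · exact h.2
          · exact absurd hu h
      have h := connected_induce_reachable G F' hr u
      rw [e] at h
      exact h
    · refine (hconn ⟨u, hu⟩).map (G := F.induce {x | (⟨u, hu⟩ : ↥Xᶜ) ∈ W x})
        (f := ⟨fun x => ⟨x.1.1, Or.inr ⟨hu, x.1.2, x.2⟩⟩, ?_⟩) ?_
      · intro a b hab
        exact hFF' ((SimpleGraph.map_adj _ _ _ _).2 ⟨a.1, b.1, hab, rfl, rfl⟩)
      · rintro ⟨x, hx⟩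
        rcases hx with hx | ⟨_, hx, h⟩
        · exact absurd hx.1 hu
        · exact ⟨⟨⟨x, hx⟩, h⟩, rfl⟩
  · have hs : ∀ u : V, u ∈ {w | w ∈ X ∧ G.Reachable w u} ∪
        {w | ∃ (hw : w ∈ Xᶜ) (hx : u ∈ Xᶜ), (⟨w, hw⟩ : ↥Xᶜ) ∈ W ⟨u, hx⟩} := by
      intro u
      by_cases hu : u ∈ X
      · exact Or.inl ⟨hu, Reachable.refl _⟩
      · exact Or.inr ⟨hu, hu, hself _⟩
    intro u v huv
    by_cases hu : u ∈ X
    · exact ⟨v, Or.inl ⟨hu, huv.reachable⟩, hs v⟩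
    by_cases hv : v ∈ X
    · exact ⟨u, hs u, Or.inl ⟨hv, huv.symm.reachable⟩⟩
    obtain ⟨x, h1, h2⟩ := hedge ⟨u, hu⟩ ⟨v, hv⟩ huv
    exact ⟨x.1, Or.inr ⟨hu, x.2, h1⟩, Or.inr ⟨hv, x.2, h2⟩⟩
  · intro u
    by_cases hu : u ∈ X
    · exact Or.inl ⟨hu, Reachable.refl _⟩
    · exact Or.inr ⟨hu, hu, hself _⟩
  · intro x
    refine (Set.ncard_union_le _ _).trans ?_
    have h1 : {u | u ∈ X ∧ G.Reachable u x}.ncard ≤ X.ncard :=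
      Set.ncard_le_ncard (fun u hu => hu.1) (Set.toFinite _)
    have h2 : {u | ∃ (hu : u ∈ Xᶜ) (hx : x ∈ Xᶜ), (⟨u, hu⟩ : ↥Xᶜ) ∈ W ⟨x, hx⟩}.ncard
        ≤ complexity (G.induce Xᶜ) + 1 := by
      by_cases hx : x ∈ X
      · have : {u | ∃ (hu : u ∈ Xᶜ) (hx : x ∈ Xᶜ), (⟨u, hu⟩ : ↥Xᶜ) ∈ W ⟨x, hx⟩} = ∅ := by
          ext u
          simp [hx]
        rw [this]
        simp
      · refine le_trans ?_ (hW ⟨x, hx⟩)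
        have : {u | ∃ (hu : u ∈ Xᶜ) (hx : x ∈ Xᶜ), (⟨u, hu⟩ : ↥Xᶜ) ∈ W ⟨x, hx⟩}
            = Subtype.val '' (W ⟨x, hx⟩) := by
          ext u
          constructor
          · rintro ⟨hu, _, h⟩
            exact ⟨_, h, rfl⟩
          · rintro ⟨u', h, rfl⟩
            exact ⟨u'.2, hx, h⟩
        rw [this]
        exact Set.ncard_image_le (Set.toFinite _)
    omega
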